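/- arXiv:0809.2590 — 2 statements merged into one kernel-verified Lean document; each statement's English description precedes it below -/
import Mathlib

section
/- Fix A₀ > 0, Λ ∈ ℝ, c ∈ ℝ, a function W_k : ℝ → ℝ, and ε ∈ (0,4) with ε ≠ 2. Define a(n) = A₀·|ε+4n+2|·| |ε+4n+3| − |ε+4n+1| | and b(n) = (a(n−1)+a(n)) − Λ·c·(ε+4n) + W_k(ε+4n). Then the operator Ĉ_gr on ℓ²(ℤ,ℂ), defined on the dense domain of finitely supported sequences by (Ĉ_gr ψ)(n) = −a(n−1)ψ(n−1) + b(n)ψ(n) − a(n)ψ(n+1), is essentially self-adjoint. -/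
open scoped ComplexInnerProductSpace

/-- The dense subspace of finitely supported sequences in `ℓ²(ℤ, ℂ)`. -/
noncomputable def finSuppZ : Submodule ℂ (lp (fun _ : ℤ => ℂ) 2) where
  carrier := {ψ | (Function.support fun n => ψ n).Finite}
  add_mem' := by
    intro ψ φ hψ hφ
    refine (hψ.union hφ).subset ?_
    intro n hn
    simp only [Function.mem_support, lp.coeFn_add, Pi.add_apply] at hn
    simp only [Set.mem_union, Function.mem_support]
    by_contra h
    push_neg at h
    exact hn (by rw [h.1, h.2, add_zero])
  zero_mem' := by
    simp only [Set.mem_setOf_eq]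
    refine Set.Finite.subset (Set.finite_empty) ?_
    intro n hn
    simp only [Function.mem_support, lp.coeFn_zero, Pi.zero_apply, ne_eq,
      not_true_eq_false] at hn
  smul_mem' := by
    intro c ψ hψ
    refine hψ.subset ?_
    intro n hn
    simp only [Function.mem_support, lp.coeFn_smul, Pi.smul_apply, smul_eq_mul] at hn
    simp only [Function.mem_support]
    exact fun h => hn (by rw [h, mul_zero])

/-- A summable real family on `ℕ` cannot dominate `δ / (n + 1)` eventually. -/
theorem not_eventually_le_succ_mul_of_summable {q : ℕ → ℝ} (hq : Summable q) {K δ : ℝ} (hδ : 0 < δ) :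
    ¬ ∀ᶠ n : ℕ in Filter.atTop, δ ≤ K * (n + 1) * q n := by
  intro h
  have hs : Summable fun n : ℕ => 1 / ((n : ℝ) + 1) := by
    refine Summable.of_norm_bounded_eventually_nat (hq.mul_left (K / δ)) ?_
    filter_upwards [h] with n hn
    have hn1 : (0 : ℝ) < n + 1 := by positivity
    rw [Real.norm_of_nonneg (by positivity), div_le_iff₀ hn1, div_mul_eq_mul_div,
      div_mul_eq_mul_div, le_div_iff₀ hδ]
    linarith
  refine Real.not_summable_one_div_natCast ((summable_nat_add_iff 1).1 ?_)
  simpa using hs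

/-- Shifted products of two square-summable sequences are summable. -/
theorem summable_norm_mul_norm_shift (f g : lp (fun _ : ℤ => ℂ) 2) (k : ℤ) :
    Summable fun n : ℤ => ‖f n‖ * ‖g (n + k)‖ := by
  have sq (u : lp (fun _ : ℤ => ℂ) 2) : Summable fun n : ℤ => ‖u n‖ ^ 2 := by
    simpa using (lp.memℓp u).summable (by simp)
  refine Summable.of_nonneg_of_le (fun n => by positivity) (fun n => ?_)
    ((sq f).add ((sq g).comp_injective (add_left_injective k)))
  simp only [Function.comp_apply]
  nlinarith [sq_nonneg (‖f n‖ - ‖g (n + k)‖), sq_nonneg ‖f n‖, sq_nonneg ‖g (n + k)‖]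

/-- Green's formula for a formal Jacobi operator whose off-diagonal coefficients grow at most
linearly: there are no boundary terms at infinity (Carleman's criterion). -/
theorem inner_jacobi_eq_inner_jacobi {a b : ℤ → ℝ} {K : ℝ} (hK : 0 < K)
    (ha : ∀ n : ℤ, |a n| ≤ K * (|(n : ℝ)| + 1)) (f g f' g' : lp (fun _ : ℤ => ℂ) 2)
    (hf : ∀ n : ℤ, f' n = -(a (n - 1) : ℂ) * f (n - 1) + (b n : ℂ) * f n - (a n : ℂ) * f (n + 1))
    (hg : ∀ n : ℤ, g' n = -(a (n - 1) : ℂ) * g (n - 1) + (b n : ℂ) * g n - (a n : ℂ) * g (n + 1)) :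
    inner ℂ f' g = inner ℂ f g' := by
  set W : ℤ → ℂ := fun n => (a (n - 1) : ℂ) *
    (g (n - 1) * starRingEnd ℂ (f n) - g n * starRingEnd ℂ (f (n - 1))) with hW
  have hsum := (lp.hasSum_inner (𝕜 := ℂ) f' g).sub (lp.hasSum_inner (𝕜 := ℂ) f g')
  have hterm : (fun n => inner ℂ (f' n) (g n) - inner ℂ (f n) (g' n))
      = fun n => W n - W (n + 1) := by
    funext n
    simp only [hW, RCLike.inner_apply, hf, hg, map_add, map_sub, map_mul, map_neg,
      Complex.conj_ofReal, add_sub_cancel_right]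
    ring
  rw [hterm] at hsum
  have hlim := hsum.comp (Finset.tendsto_Ico_neg (R := ℤ))
  simp only [Function.comp_def, Finset.sum_Ico_int_sub] at hlim
  set q : ℤ → ℝ := fun n => ‖g (n - 1)‖ * ‖f n‖ + ‖g n‖ * ‖f (n - 1)‖ with hq
  have hqs : Summable q := by
    refine Summable.add ?_ (by simpa [sub_eq_add_neg] using summable_norm_mul_norm_shift g f (-1))
    simpa [sub_eq_add_neg, mul_comm] using summable_norm_mul_norm_shift f g (-1)
  have hWq (n : ℤ) : ‖W n‖ ≤ 2 * K * (|(n : ℝ)| + 1) * q n := by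
    have h1 : ‖g (n - 1) * starRingEnd ℂ (f n) - g n * starRingEnd ℂ (f (n - 1))‖ ≤ q n := by
      refine (norm_sub_le _ _).trans_eq ?_
      simp [hq]
    have h2 : |a (n - 1)| ≤ 2 * K * (|(n : ℝ)| + 1) := by
      refine (ha (n - 1)).trans ?_
      have h3 : |(n : ℝ) - 1| ≤ |(n : ℝ)| + 1 := by simpa using abs_sub (n : ℝ) 1
      push_cast
      nlinarith [abs_nonneg (n : ℝ)]
    simp only [hW, norm_mul, Complex.norm_real, Real.norm_eq_abs]
    exact mul_le_mul h2 h1 (norm_nonneg _) (by positivity)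
  by_contra hne
  have hpos : 0 < ‖inner ℂ f' g - inner ℂ f g'‖ := norm_pos_iff.2 (sub_ne_zero.2 hne)
  have hpair : Summable fun n : ℕ => q (-(n : ℤ)) + q n :=
    (hqs.comp_injective (neg_injective.comp Nat.cast_injective)).add
      (hqs.comp_injective Nat.cast_injective)
  refine not_eventually_le_succ_mul_of_summable hpair (K := 2 * K) (half_pos hpos) ?_
  filter_upwards [hlim.norm.eventually (lt_mem_nhds (half_lt_self hpos))] with n hn
  have h1 := hWq (-(n : ℤ))
  have h2 := hWq n
  simp only [Int.cast_neg, Int.cast_natCast, abs_neg, Nat.abs_cast] at h1 h2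
  have h3 := norm_sub_le (W (-(n : ℤ))) (W n)
  linarith

theorem single_mem_finSuppZ (n : ℤ) (z : ℂ) : lp.single (E := fun _ : ℤ => ℂ) 2 n z ∈ finSuppZ := by
  refine (Set.finite_singleton n).subset fun m hm => ?_
  by_contra hmn
  exact hm (lp.single_apply_ne (E := fun _ : ℤ => ℂ) 2 n z hmn)

theorem dense_finSuppZ : Dense (finSuppZ : Set (lp (fun _ : ℤ => ℂ) 2)) := fun f =>
  mem_closure_of_tendsto (lp.hasSum_single (by simp) f) <| Filter.Eventually.of_forall fun _ =>
    Submodule.sum_mem _ fun n _ => single_mem_finSuppZ n _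

/-- The adjoint of a Jacobi operator on finitely supported sequences acts by the same formula. -/
theorem adjoint_jacobi_apply {a b : ℤ → ℝ}
    {T : lp (fun _ : ℤ => ℂ) 2 →ₗ.[ℂ] lp (fun _ : ℤ => ℂ) 2} (hdom : T.domain = finSuppZ)
    (hT : ∀ ψ : T.domain, ∀ n : ℤ,
      T ψ n = -(a (n - 1) : ℂ) * (ψ : lp (fun _ : ℤ => ℂ) 2) (n - 1)
        + (b n : ℂ) * (ψ : lp (fun _ : ℤ => ℂ) 2) n
        - (a n : ℂ) * (ψ : lp (fun _ : ℤ => ℂ) 2) (n + 1))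
    (y : T.adjoint.domain) (n : ℤ) :
    T.adjoint y n = -(a (n - 1) : ℂ) * (y : lp (fun _ : ℤ => ℂ) 2) (n - 1)
      + (b n : ℂ) * (y : lp (fun _ : ℤ => ℂ) 2) n
      - (a n : ℂ) * (y : lp (fun _ : ℤ => ℂ) 2) (n + 1) := by
  have hdense : Dense (T.domain : Set (lp (fun _ : ℤ => ℂ) 2)) := hdom ▸ dense_finSuppZ
  let e : T.domain := ⟨lp.single 2 n 1, hdom ▸ single_mem_finSuppZ n 1⟩
  have hTe : T e = lp.single 2 (n - 1) (-(a (n - 1) : ℂ)) + lp.single 2 n (b n : ℂ)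
      + lp.single 2 (n + 1) (-(a n : ℂ)) := by
    ext m
    rw [hT]
    simp only [e, lp.coeFn_add, Pi.add_apply, lp.single_apply, Pi.single_apply]
    by_cases h1 : m = n - 1
    · subst h1; simp [show n - 1 - 1 ≠ n by omega, show n - 1 ≠ n + 1 by omega]
    by_cases h2 : m = n
    · subst h2; simp [show m ≠ m - 1 by omega]
    by_cases h3 : m = n + 1
    · subst h3; simp [show n + 1 + 1 ≠ n by omega, show n + 1 ≠ n - 1 by omega]
    simp [h1, h2, h3, show m - 1 ≠ n by omega, show m + 1 ≠ n by omega]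
  have h := T.adjoint_isFormalAdjoint hdense y e
  rw [hTe, inner_add_right, inner_add_right] at h
  simp only [e, lp.inner_single_right, RCLike.inner_apply] at h
  have h' := congrArg (starRingEnd ℂ) h
  simp only [map_add, map_mul, map_neg, Complex.conj_conj, Complex.conj_ofReal,
    one_mul] at h'
  rw [h']
  ring

/-- The LQC gravitational constraint operator
`Ĉ_gr = i(h₂−h₋₂)A(V̂)i(h₂−h₋₂) − ΛV̂ + W_k(V̂)` with the APS choice
`A(v) = A₀|v|·||v+1|−|v−1||`, restricted to the superselection lattice `ε+4ℤ`
(with `ε ∈ (0,4)`, `ε ≠ 2`) and acting on `ℓ²(ℤ, ℂ)` by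
`(Ĉ_gr ψ)(n) = −a(n−1)ψ(n−1) + b(n)ψ(n) − a(n)ψ(n+1)` with
`a(n) = A₀·|ε+4n+2|·||ε+4n+3| − |ε+4n+1||` and
`b(n) = (a(n−1)+a(n)) − Λ·c·(ε+4n) + W_k(ε+4n)`, is essentially self-adjoint
on the dense domain of finitely supported sequences, for every cosmological
constant `Λ` and every potential term `W_k`. -/
theorem stmt3 (A₀ : ℝ) (hA₀ : 0 < A₀) (Λ c : ℝ) (W_k : ℝ → ℝ)
    (ε : ℝ) (hε : ε ∈ Set.Ioo (0 : ℝ) 4) (hε2 : ε ≠ 2)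
    (a b : ℤ → ℝ)
    (ha : ∀ n : ℤ,
      a n = A₀ * |ε + 4 * n + 2| * abs (|ε + 4 * n + 3| - |ε + 4 * n + 1|))
    (hb : ∀ n : ℤ, b n = (a (n - 1) + a n) - Λ * c * (ε + 4 * n) + W_k (ε + 4 * n))
    (Cgr : lp (fun _ : ℤ => ℂ) 2 →ₗ.[ℂ] lp (fun _ : ℤ => ℂ) 2)
    (hdom : Cgr.domain = finSuppZ)
    (hC : ∀ ψ : Cgr.domain, ∀ n : ℤ,
      Cgr ψ n = -(a (n - 1) : ℂ) * (ψ : lp (fun _ : ℤ => ℂ) 2) (n - 1)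
        + (b n : ℂ) * (ψ : lp (fun _ : ℤ => ℂ) 2) n
        - (a n : ℂ) * (ψ : lp (fun _ : ℤ => ℂ) 2) (n + 1)) :
    Dense (Cgr.domain : Set (lp (fun _ : ℤ => ℂ) 2)) ∧ IsSelfAdjoint Cgr.adjoint := by
  have hdense : Dense (Cgr.domain : Set (lp (fun _ : ℤ => ℂ) 2)) := hdom ▸ dense_finSuppZ
  have hgrowth (n : ℤ) : |a n| ≤ 12 * A₀ * (|(n : ℝ)| + 1) := by
    have h1 : |ε + 4 * n + 2| ≤ 6 * (|(n : ℝ)| + 1) := by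
      rw [abs_le]
      constructor <;> nlinarith [hε.1, hε.2, le_abs_self (n : ℝ), neg_abs_le (n : ℝ)]
    have h2 : |(|ε + 4 * n + 3| - |ε + 4 * n + 1|)| ≤ 2 := by
      refine (abs_abs_sub_abs_le_abs_sub _ _).trans_eq ?_
      rw [show ε + 4 * n + 3 - (ε + 4 * n + 1) = 2 by ring]
      norm_num
    rw [ha, abs_of_nonneg (by positivity), mul_assoc]
    have h3 := mul_le_mul h1 h2 (abs_nonneg _) (by positivity)
    nlinarith
  have hK : 0 < 12 * A₀ := by positivity
  have hadj := adjoint_jacobi_apply hdom hC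
  have hsymm : Cgr.IsFormalAdjoint Cgr := fun x y =>
    inner_jacobi_eq_inner_jacobi hK hgrowth x y _ _ (hC x) (hC y)
  have hsymm' : Cgr.adjoint.IsFormalAdjoint Cgr.adjoint := fun x y =>
    inner_jacobi_eq_inner_jacobi hK hgrowth x y _ _ (hadj x) (hadj y)
  have hle : Cgr ≤ Cgr.adjoint := hsymm.le_adjoint hdense
  have hdense' : Dense (Cgr.adjoint.domain : Set (lp (fun _ : ℤ => ℂ) 2)) := hdense.mono hle.1
  refine ⟨hdense, LinearPMap.isSelfAdjoint_def.2 (le_antisymm ?_ (hsymm'.le_adjoint hdense'))⟩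
  refine LinearPMap.IsFormalAdjoint.le_adjoint hdense fun x y => ?_
  have hxy := Cgr.adjoint.adjoint_isFormalAdjoint hdense'
  rw [hle.2 (x := x) (y := ⟨x, hle.1 x.2⟩) rfl]
  exact hxy.symm ⟨x, hle.1 x.2⟩ y
end

section
/- Fix ρ_c > 0 and ε ∈ ℝ. With f, a and ρ̂₁ as follows: f(v) = (27/8)·|v|·| |v+1|^{1/3} − |v−1|^{1/3} |³ · |v|·| |v+1| − |v−1| |, a(n) = f(ε+4n+2), and (ρ̂₁ψ)(n) = (ρ_c/8)·[(a(n−1)+a(n))ψ(n) − a(n−1)ψ(n−1) − a(n)ψ(n+1)] on ℓ²(ℤ,ℂ). Then every λ in the spectrum of ρ̂₁ with λ ∉ [0, ρ_c] is an eigenvalue of ρ̂₁, i.e. there exists a nonzero ψ ∈ ℓ²(ℤ,ℂ) with ρ̂₁ψ = λψ. -/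
/-- `f(v) = B_APS(v)·Ã_APS(v)
  = (27/8)·|v|·| |v+1|^(1/3) − |v−1|^(1/3) |³ · |v|·| |v+1| − |v−1| |`. -/
noncomputable def fAPS (v : ℝ) : ℝ :=
  (27 / 8) * |v| * (abs (|v + 1| ^ ((1 : ℝ) / 3) - |v - 1| ^ ((1 : ℝ) / 3))) ^ (3 : ℕ)
    * (|v| * abs (|v + 1| - |v - 1|))

/-- The lattice coefficients `a(n) = f(ε+4n+2)`. -/
noncomputable def aAPS (ε : ℝ) (n : ℤ) : ℝ := fAPS (ε + 4 * n + 2)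

open Filter Topology

/-- Fredholm alternative for compact perturbations: a spectral point of `A` outside the spectrum of
`A₀` is an eigenvalue of `A` when `A - A₀` is compact. -/
theorem exists_eigenvector_of_isCompactOperator_sub {𝕜 X : Type*} [NontriviallyNormedField 𝕜]
    [NormedAddCommGroup X] [NormedSpace 𝕜 X] [CompleteSpace X] {A A₀ : X →L[𝕜] X}
    (hK : IsCompactOperator (A - A₀)) {z : 𝕜} (hz : z ∈ spectrum 𝕜 A) (hz₀ : z ∉ spectrum 𝕜 A₀) :
    ∃ x : X, x ≠ 0 ∧ A x = z • x := by
  rw [spectrum.notMem_iff] at hz₀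
  obtain ⟨u, hu⟩ := hz₀
  have hT : IsCompactOperator ((↑u⁻¹ : X →L[𝕜] X) * (A - A₀)) := hK.clm_comp _
  have hdecomp : algebraMap 𝕜 (X →L[𝕜] X) z - A
      = u * (1 - (↑u⁻¹ : X →L[𝕜] X) * (A - A₀)) := by
    rw [mul_sub, mul_one, ← mul_assoc, Units.mul_inv, one_mul, hu]
    abel
  rcases hT.hasEigenvalue_or_mem_resolventSet one_ne_zero with h | h
  · obtain ⟨x, hx⟩ := h.exists_hasEigenvector
    have h1 := hx.apply_eq_smul
    refine ⟨x, hx.2, ?_⟩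
    have h2 : (algebraMap 𝕜 (X →L[𝕜] X) z - A) x = 0 := by
      rw [hdecomp]
      have : (1 - (↑u⁻¹ : X →L[𝕜] X) * (A - A₀)) x = 0 := by
        rw [one_smul] at h1
        exact sub_eq_zero.2 h1.symm
      rw [mul_apply_eq_comp, this, map_zero]
    rw [sub_apply, sub_eq_zero] at h2
    rw [← h2, Algebra.algebraMap_eq_smul_one]
    rfl
  · refine absurd ?_ (spectrum.mem_iff.1 hz)
    rw [hdecomp]
    rw [spectrum.mem_resolventSet_iff, map_one] at h
    exact u.isUnit.mul h

/-- The spectrum of `a⋆ a` lies in `[0, ‖a‖²]`. -/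
theorem exists_mem_Icc_of_mem_spectrum_star_mul_self {A : Type*} [CStarAlgebra A] [NormOneClass A]
    {a : A} {z : ℂ} (hz : z ∈ spectrum ℂ (star a * a)) :
    ∃ x ∈ Set.Icc (0 : ℝ) (‖a‖ * ‖a‖), (x : ℂ) = z := by
  have hre : (z.re : ℂ) = z := ((IsSelfAdjoint.star_mul_self a).mem_spectrum_eq_re hz).symm
  refine ⟨z.re, ⟨?_, ?_⟩, hre⟩
  · refine spectrum_star_mul_self_nonneg (b := a) z.re ?_
    rw [← hre] at hz
    exact (spectrum.algebraMap_mem_iff (R := ℝ) ℂ).1 hz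
  · calc z.re ≤ ‖z‖ := Complex.re_le_norm z
      _ ≤ ‖star a * a‖ := spectrum.norm_le_norm_of_mem hz
      _ = ‖a‖ * ‖a‖ := CStarRing.norm_star_mul_self

namespace lp

local notation "ℓ²" => lp (fun _ : ℤ => ℂ) 2

instance : Nontrivial ℓ² :=
  ⟨⟨lp.single 2 0 1, 0, fun h => one_ne_zero (α := ℂ) <| by
    rw [← lp.single_apply_self (E := fun _ : ℤ => ℂ) 2 0 1, h]
    rfl⟩⟩

theorem memℓp_translate (k : ℤ) (ψ : ℓ²) : Memℓp (fun n => ψ (n + k)) 2 := by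
  have h := (lp.memℓp ψ).summable (by norm_num)
  exact memℓp_gen ((Equiv.addRight k).summable_iff.2 h)

/-- Translation by `k` on `ℓ²(ℤ)`. -/
noncomputable def translate (k : ℤ) : ℓ² →ₗᵢ[ℂ] ℓ² where
  toFun ψ := ⟨fun n => ψ (n + k), memℓp_translate k ψ⟩
  map_add' _ _ := rfl
  map_smul' _ _ := rfl
  norm_map' ψ := by
    have h2 : 0 < (2 : ENNReal).toReal := by norm_num
    rw [lp.norm_eq_tsum_rpow h2, lp.norm_eq_tsum_rpow h2]
    congr 1
    exact (Equiv.addRight k).tsum_eq (fun n => ‖ψ n‖ ^ (2 : ENNReal).toReal)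

@[simp]
theorem translate_apply (k : ℤ) (ψ : ℓ²) (n : ℤ) : translate k ψ n = ψ (n + k) := rfl

theorem star_translate (k : ℤ) :
    star (translate k).toContinuousLinearMap = (translate (-k)).toContinuousLinearMap := by
  rw [ContinuousLinearMap.star_eq_adjoint, eq_comm, ContinuousLinearMap.eq_adjoint_iff]
  intro x y
  rw [lp.inner_eq_tsum, lp.inner_eq_tsum,
    ← (Equiv.addRight k).tsum_eq (fun n => inner ℂ _ (y n))]
  simp

theorem norm_le_of_forall_norm_le_mul {f g : ℓ²} {C : ℝ} (hC : 0 ≤ C)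
    (h : ∀ n, ‖f n‖ ≤ C * ‖g n‖) : ‖f‖ ≤ C * ‖g‖ := by
  have h1 : ‖f‖ ≤ ‖(C : ℂ) • g‖ := by
    refine lp.norm_mono two_ne_zero fun n => ?_
    rw [lp.coeFn_smul, Pi.smul_apply, norm_smul, Complex.norm_real, Real.norm_of_nonneg hC]
    exact h n
  rwa [norm_smul, Complex.norm_real, Real.norm_of_nonneg hC] at h1

/-- Multiplication by a bounded sequence on `ℓ²(ℤ)`. -/
noncomputable def diagonal (b : ℤ → ℂ) (C : ℝ) (hC : 0 ≤ C) (hb : ∀ n, ‖b n‖ ≤ C) : ℓ² →L[ℂ] ℓ² :=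
  LinearMap.mkContinuous
    { toFun := fun ψ => ⟨fun n => b n * ψ n, by
        refine ((lp.memℓp ψ).const_smul (C : ℂ)).mono' fun n => ?_
        simpa [abs_of_nonneg hC] using mul_le_mul_of_nonneg_right (hb n) (norm_nonneg (ψ n))⟩
      map_add' := fun _ _ => lp.ext <| funext fun n => mul_add (b n) _ _
      map_smul' := fun c _ => lp.ext <| funext fun n => mul_left_comm (b n) c _ } C
    fun ψ => norm_le_of_forall_norm_le_mul hC fun n => by
      simpa using mul_le_mul_of_nonneg_right (hb n) (norm_nonneg (ψ n))

@[simp]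
theorem diagonal_apply {b : ℤ → ℂ} {C : ℝ} (hC : 0 ≤ C) (hb : ∀ n, ‖b n‖ ≤ C) (ψ : ℓ²) (n : ℤ) :
    diagonal b C hC hb ψ n = b n * ψ n := rfl

theorem isCompactOperator_diagonal {b : ℤ → ℂ} {C : ℝ} (hC : 0 ≤ C) (hb : ∀ n, ‖b n‖ ≤ C)
    (hb0 : Tendsto b cofinite (𝓝 0)) : IsCompactOperator (diagonal b C hC hb) := by
  let F : Finset ℤ → ℓ² →L[ℂ] ℓ² := fun s => ∑ i ∈ s,
    b i • (lp.singleContinuousLinearMap ℂ (fun _ : ℤ => ℂ) 2 i).comp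
      (lp.evalCLM ℂ (fun _ : ℤ => ℂ) 2 i)
  have hF (s : Finset ℤ) (ψ : ℓ²) (n : ℤ) : F s ψ n = if n ∈ s then b n * ψ n else 0 := by
    have h1 : F s ψ = ∑ i ∈ s, b i • lp.single 2 i (ψ i) := by
      simp only [F, sum_apply]
      rfl
    rw [h1, lp.coeFn_sum, Finset.sum_apply]
    simp [Pi.single_apply]
  refine isCompactOperator_of_tendsto (F := F) (l := atTop) ?_ (Eventually.of_forall fun s => ?_)
  · rw [Metric.tendsto_nhds]
    intro δ hδ
    have hfin : {n | ¬ ‖b n‖ < δ / 2}.Finite := by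
      have := (Metric.tendsto_nhds.1 hb0) (δ / 2) (half_pos hδ)
      simpa only [dist_zero_right, eventually_cofinite] using this
    filter_upwards [eventually_ge_atTop hfin.toFinset] with s hs
    rw [dist_eq_norm]
    refine lt_of_le_of_lt ?_ (half_lt_self hδ)
    refine ContinuousLinearMap.opNorm_le_bound _ (half_pos hδ).le fun ψ => ?_
    refine norm_le_of_forall_norm_le_mul (half_pos hδ).le fun n => ?_
    rw [sub_apply, lp.coeFn_sub, Pi.sub_apply, hF, diagonal_apply]
    split_ifs with hn
    · simpa using by positivity
    · have : ‖b n‖ < δ / 2 := by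
        by_contra h
        exact hn (hs (hfin.mem_toFinset.2 h))
      calc ‖0 - b n * ψ n‖ = ‖b n‖ * ‖ψ n‖ := by simp
        _ ≤ δ / 2 * ‖ψ n‖ := by gcongr
  · refine Submodule.sum_mem (compactOperator (RingHom.id ℂ) ℓ² ℓ²) fun i _ => ?_
    refine IsCompactOperator.smul ?_ (b i)
    have he : IsCompactOperator (lp.evalCLM ℂ (fun _ : ℤ => ℂ) 2 i) :=
      isCompactOperator_of_locallyCompactSpace_dom (M₂ := ℂ) _
    exact he.clm_comp (lp.singleContinuousLinearMap ℂ (fun _ : ℤ => ℂ) 2 i)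

end lp

theorem fAPS_abs (v : ℝ) : fAPS |v| = fAPS v := by
  rcases abs_choice v with h | h <;> rw [h]
  have h1 : |-v + 1| = |v - 1| := by rw [← abs_neg]; congr 1; ring
  have h2 : |-v - 1| = |v + 1| := by rw [← abs_neg]; congr 1; ring
  unfold fAPS
  rw [h1, h2, abs_neg, abs_sub_comm (|v - 1|), abs_sub_comm (|v - 1| ^ ((1 : ℝ) / 3))]

theorem fAPS_eq_of_one_lt {v : ℝ} (hv : 1 < v) :
    fAPS v = 54 / (((1 + v⁻¹) ^ ((1 : ℝ) / 3)) ^ 2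
      + (1 + v⁻¹) ^ ((1 : ℝ) / 3) * (1 - v⁻¹) ^ ((1 : ℝ) / 3)
      + ((1 - v⁻¹) ^ ((1 : ℝ) / 3)) ^ 2) ^ 3 := by
  have hv0 : 0 < v := by linarith
  have hi : v⁻¹ < 1 := inv_lt_one_of_one_lt₀ hv
  have hi0 : 0 < v⁻¹ := inv_pos.2 hv0
  have e1 : v + 1 = v * (1 + v⁻¹) := by field_simp
  have e2 : v - 1 = v * (1 - v⁻¹) := by field_simp
  have cube {t : ℝ} (ht : 0 ≤ t) : (t ^ ((1 : ℝ) / 3)) ^ 3 = t := by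
    rw [← Real.rpow_natCast, ← Real.rpow_mul ht]; norm_num
  unfold fAPS
  rw [abs_of_pos hv0, abs_of_pos (show 0 < v + 1 by linarith),
    abs_of_pos (show 0 < v - 1 by linarith), e1, e2,
    Real.mul_rpow hv0.le (by linarith), Real.mul_rpow hv0.le (by linarith), ← mul_sub, ← mul_sub]
  have hx3 := cube (show 0 ≤ 1 + v⁻¹ by linarith)
  have hy3 := cube (show 0 ≤ 1 - v⁻¹ by linarith)
  have hr3 := cube hv0.le
  have hxy : (1 - v⁻¹) ^ ((1 : ℝ) / 3) ≤ (1 + v⁻¹) ^ ((1 : ℝ) / 3) :=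
    Real.rpow_le_rpow (by linarith) (by linarith) (by norm_num)
  have hx : 0 < (1 + v⁻¹) ^ ((1 : ℝ) / 3) := Real.rpow_pos_of_pos (by linarith) _
  have hy : 0 < (1 - v⁻¹) ^ ((1 : ℝ) / 3) := Real.rpow_pos_of_pos (by linarith) _
  have hr : 0 < v ^ ((1 : ℝ) / 3) := Real.rpow_pos_of_pos hv0 _
  have hd : 1 + v⁻¹ - (1 - v⁻¹) = 2 * v⁻¹ := by ring
  rw [abs_of_nonneg (mul_nonneg hr.le (sub_nonneg.2 hxy)), mul_pow, hr3, hd,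
    abs_of_pos (by positivity)]
  generalize (1 + v⁻¹) ^ ((1 : ℝ) / 3) = x at *
  generalize (1 - v⁻¹) ^ ((1 : ℝ) / 3) = y at *
  have key : (x - y) * (x ^ 2 + x * y + y ^ 2) = 2 * v⁻¹ := by linear_combination hx3 - hy3
  rw [eq_div_iff (by positivity)]
  have : 27 / 8 * v * (v * (x - y) ^ 3) * (v * (v * (2 * v⁻¹))) * (x ^ 2 + x * y + y ^ 2) ^ 3
      = 27 / 8 * v * (v * (v * (v * (2 * v⁻¹)))) * ((x - y) * (x ^ 2 + x * y + y ^ 2)) ^ 3 := by ring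
  rw [this, key]
  field_simp
  norm_num

theorem tendsto_fAPS_atTop : Tendsto fAPS atTop (𝓝 2) := by
  have hcont : ContinuousAt (fun t : ℝ => 54 / (((1 + t) ^ ((1 : ℝ) / 3)) ^ 2
      + (1 + t) ^ ((1 : ℝ) / 3) * (1 - t) ^ ((1 : ℝ) / 3)
      + ((1 - t) ^ ((1 : ℝ) / 3)) ^ 2) ^ 3) 0 := by
    have h1 : ContinuousAt (fun t : ℝ => (1 + t) ^ ((1 : ℝ) / 3)) 0 :=
      ContinuousAt.rpow_const (by fun_prop) (by norm_num)
    have h2 : ContinuousAt (fun t : ℝ => (1 - t) ^ ((1 : ℝ) / 3)) 0 :=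
      ContinuousAt.rpow_const (by fun_prop) (by norm_num)
    refine ContinuousAt.div continuousAt_const (by fun_prop) (by norm_num)
  have h := hcont.tendsto.comp tendsto_inv_atTop_zero
  norm_num at h
  refine h.congr' ?_
  filter_upwards [eventually_gt_atTop 1] with v hv
  rw [fAPS_eq_of_one_lt hv]
  norm_num

theorem tendsto_aAPS_cofinite (ε : ℝ) : Tendsto (aAPS ε) cofinite (𝓝 2) := by
  have h1 : Tendsto (fun n : ℤ => |ε + 4 * n + 2|) cofinite atTop := by
    rw [Int.cofinite_eq, tendsto_sup]
    have hb : Tendsto (fun n : ℤ => (n : ℝ)) atBot atBot := tendsto_intCast_atBot_iff.2 tendsto_id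
    have ht : Tendsto (fun n : ℤ => (n : ℝ)) atTop atTop := tendsto_intCast_atTop_iff.2 tendsto_id
    constructor
    · exact tendsto_abs_atBot_atTop.comp (tendsto_atBot_add_const_right _ _
        (tendsto_atBot_add_const_left _ _ (hb.const_mul_atBot (by norm_num))))
    · exact tendsto_abs_atTop_atTop.comp (tendsto_atTop_add_const_right _ _
        (tendsto_atTop_add_const_left _ _ (ht.const_mul_atTop (by norm_num))))
  refine (tendsto_fAPS_atTop.comp h1).congr fun n => ?_
  exact fAPS_abs _

/-- Every spectral point of the APS scalar field energy density operator `ρ̂₁` lying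
outside the interval `[0, ρ_c]` is an eigenvalue of `ρ̂₁`. -/
theorem stmt11 (ρc : ℝ) (hρc : 0 < ρc) (ε : ℝ)
    (ρ₁ : lp (fun _ : ℤ => ℂ) 2 →L[ℂ] lp (fun _ : ℤ => ℂ) 2)
    (hρ₁ : ∀ ψ : lp (fun _ : ℤ => ℂ) 2, ∀ n : ℤ,
      ρ₁ ψ n = (ρc / 8 : ℂ) * (((aAPS ε (n - 1) : ℝ) + aAPS ε n : ℝ) * ψ n
        - (aAPS ε (n - 1) : ℂ) * ψ (n - 1) - (aAPS ε n : ℂ) * ψ (n + 1)))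
    (lam : ℂ) (hlam : lam ∈ spectrum ℂ ρ₁)
    (hlam' : lam ∉ (fun x : ℝ => (x : ℂ)) '' Set.Icc 0 ρc) :
    ∃ ψ : lp (fun _ : ℤ => ℂ) 2, ψ ≠ 0 ∧ ρ₁ ψ = lam • ψ := by
  let D : lp (fun _ : ℤ => ℂ) 2 →L[ℂ] lp (fun _ : ℤ => ℂ) 2 :=
    (lp.translate 1).toContinuousLinearMap - 1
  have hD (ψ : lp (fun _ : ℤ => ℂ) 2) (n : ℤ) : D ψ n = ψ (n + 1) - ψ n := rfl
  have hDstar (ψ : lp (fun _ : ℤ => ℂ) 2) (n : ℤ) : star D ψ n = ψ (n - 1) - ψ n := by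
    rw [star_sub, star_one, lp.star_translate]
    rfl
  have hDnorm : ‖D‖ ≤ 2 := by
    refine (norm_sub_le _ _).trans ?_
    have := (lp.translate 1).norm_toContinuousLinearMap_le
    rw [norm_one]
    linarith
  let b : ℤ → ℂ := fun n => ((aAPS ε n - 2 : ℝ) : ℂ)
  have hb0 : Tendsto b cofinite (𝓝 0) := by
    have := (tendsto_aAPS_cofinite ε).sub_const 2
    rw [sub_self] at this
    exact_mod_cast (Complex.continuous_ofReal.tendsto 0).comp this
  obtain ⟨C, hC, hb⟩ : ∃ C : ℝ, 0 ≤ C ∧ ∀ n, ‖b n‖ ≤ C := by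
    obtain ⟨C, hC⟩ := hb0.norm.bddAbove_range_of_cofinite
    have hb (n : ℤ) : ‖b n‖ ≤ C := hC ⟨n, rfl⟩
    exact ⟨C, (norm_nonneg _).trans (hb 0), hb⟩
  let s : ℂ := (Real.sqrt (ρc / 4) : ℝ)
  have hs : star s * s = ρc / 4 := by
    simp only [s, Complex.star_def, Complex.conj_ofReal]
    rw [← Complex.ofReal_mul, Real.mul_self_sqrt (by positivity)]
    push_cast
    rfl
  have hsnorm : ‖s‖ * ‖s‖ = ρc / 4 := by
    simp only [s, Complex.norm_real, Real.norm_eq_abs, abs_mul_abs_self]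
    exact Real.mul_self_sqrt (by positivity)
  refine exists_eigenvector_of_isCompactOperator_sub (A₀ := star (s • D) * (s • D)) ?_ hlam ?_
  · have hK : ρ₁ - star (s • D) * (s • D)
        = (ρc / 8 : ℂ) • (star D * (lp.diagonal b C hC hb * D)) := by
      ext ψ n
      rw [star_smul, smul_mul_smul_comm, hs]
      simp only [sub_apply, smul_apply, mul_apply_eq_comp, lp.coeFn_sub,
        lp.coeFn_smul, Pi.sub_apply, Pi.smul_apply, hρ₁, hDstar, hD, lp.diagonal_apply, smul_eq_mul]
      simp only [sub_add_cancel, b]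
      push_cast
      ring
    rw [hK]
    have hd := lp.isCompactOperator_diagonal hC hb hb0
    exact ((hd.comp_clm D).clm_comp (star D)).smul (ρc / 8 : ℂ)
  · intro h
    obtain ⟨x, hx, hxz⟩ := exists_mem_Icc_of_mem_spectrum_star_mul_self h
    refine hlam' ⟨x, ⟨hx.1, hx.2.trans ?_⟩, hxz⟩
    rw [norm_smul]
    calc ‖s‖ * ‖D‖ * (‖s‖ * ‖D‖) = ‖s‖ * ‖s‖ * (‖D‖ * ‖D‖) := by ring
      _ ≤ ρc / 4 * (2 * 2) := by rw [hsnorm]; gcongr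
      _ = ρc := by ring
end
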